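/- arXiv:1504.01612 — 2 statements merged into one kernel-verified Lean document; each statement's English description precedes it below -/
import Mathlib

section
/- Fix β ∈ (0,1) and set x_n = ⌊n^β⌋. Let Z_n be a random variable with density f_{n,x_n} and let Z̃_n = n^{1−β/2}·(Z_n − n^{β−1}). Then Z̃_n converges weakly (in distribution) to a standard Gaussian random variable as n → ∞. -/
open MeasureTheory Real Filter

/-- The Beta(x+1, n-x+1) posterior density `f_{n,x}` on `[0,1]`, extended by `0` outside. -/
noncomputable def betaDensity (n x : ℕ) (p : ℝ) : ℝ :=
  if 0 ≤ p ∧ p ≤ 1 then ((n : ℝ) + 1) * (n.choose x : ℝ) * p ^ x * (1 - p) ^ (n - x) else 0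

/-- The standard Gaussian density. -/
noncomputable def stdGaussianDensity (z : ℝ) : ℝ :=
  Real.exp (-z ^ 2 / 2) / Real.sqrt (2 * Real.pi)

/-- Density of the standardized variable `Z̃_n = n^{1-β/2} (Z_n - n^{β-1})` where `Z_n`
has density `f_{n, ⌊n^β⌋}`. -/
noncomputable def tildeDensityBeta (β : ℝ) (n : ℕ) (z : ℝ) : ℝ :=
  (n : ℝ) ^ (β / 2 - 1) *
    betaDensity n (Nat.floor ((n : ℝ) ^ β))
      ((n : ℝ) ^ (β - 1) + (n : ℝ) ^ (β / 2 - 1) * z)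

/-- The beta density relative to its value at the reference point, in the rescaled coordinate. -/
noncomputable def betaKernel (k j : ℕ) (a b z : ℝ) : ℝ :=
  if 0 ≤ 1 + a * z ∧ 0 ≤ 1 - b * z then (1 + a * z) ^ k * (1 - b * z) ^ j else 0

theorem measurable_betaKernel (k j : ℕ) (a b : ℝ) : Measurable (betaKernel k j a b) := by
  unfold betaKernel
  refine Measurable.ite ?_ (by fun_prop) (by fun_prop)
  have h1 : Measurable fun z : ℝ => 1 + a * z := by fun_prop
  have h2 : Measurable fun z : ℝ => 1 - b * z := by fun_prop
  exact (measurableSet_le measurable_const h1).inter (measurableSet_le measurable_const h2)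

theorem betaKernel_nonneg (k j : ℕ) (a b z : ℝ) : 0 ≤ betaKernel k j a b z := by
  unfold betaKernel
  split_ifs with h
  · exact mul_nonneg (pow_nonneg h.1 _) (pow_nonneg h.2 _)
  · exact le_rfl

theorem one_add_le_exp_sub_sq_div {u : ℝ} (hu : 0 ≤ 1 + u) :
    1 + u ≤ exp (u - u ^ 2 / (2 * (2 + |u|))) := by
  set t := √(1 + u) with ht
  have ht0 : 0 ≤ t := Real.sqrt_nonneg _
  have ht2 : t ^ 2 = 1 + u := Real.sq_sqrt hu
  have h1 : t ≤ exp (t - 1) := by linarith [add_one_le_exp (t - 1)]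
  have h2 : 1 + u ≤ exp (2 * (t - 1)) := by
    rw [← ht2, two_mul, exp_add, ← sq]
    gcongr
  refine h2.trans (exp_le_exp.2 ?_)
  have h3 : u = t ^ 2 - 1 := by linarith
  have h4 : u ^ 2 / (2 * (2 + |u|)) ≤ (t - 1) ^ 2 := by
    rw [div_le_iff₀ (by positivity)]
    have h5 : u ≤ |u| := le_abs_self u
    have h6 : (t + 1) ^ 2 ≤ 2 * (2 + |u|) := by nlinarith [sq_nonneg (t - 1)]
    calc u ^ 2 = (t - 1) ^ 2 * (t + 1) ^ 2 := by rw [h3]; ring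
      _ ≤ _ := by gcongr
  nlinarith

theorem one_add_pow_mul_one_sub_pow_le {u v : ℝ} (k j : ℕ) (hu : 0 ≤ 1 + u) (hv : 0 ≤ 1 - v) :
    (1 + u) ^ k * (1 - v) ^ j ≤ exp (k * u - j * v - k * (u ^ 2 / (2 * (2 + |u|)))) := by
  have h1 : (1 + u) ^ k ≤ exp (k * (u - u ^ 2 / (2 * (2 + |u|)))) := by
    rw [exp_nat_mul]
    exact pow_le_pow_left₀ hu (one_add_le_exp_sub_sq_div hu) k
  have h2 : (1 - v) ^ j ≤ exp (j * -v) := by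
    rw [exp_nat_mul]
    exact pow_le_pow_left₀ hv (by linarith [add_one_le_exp (-v)]) j
  calc _ ≤ exp (k * (u - u ^ 2 / (2 * (2 + |u|)))) * exp (j * -v) := by gcongr
    _ = _ := by rw [← exp_add]; ring_nf

theorem betaKernel_le {k j : ℕ} {s b : ℝ} (hs : 1 ≤ s) (hk : s ^ 2 / 2 ≤ k)
    (hb : |(k : ℝ) / s - j * b| ≤ 1 / 8) (z : ℝ) :
    betaKernel k j s⁻¹ b z ≤ exp (1 / 2 - |z| / 8) := by
  unfold betaKernel
  split_ifs with h
  · refine (one_add_pow_mul_one_sub_pow_le k j h.1 h.2).trans (exp_le_exp.2 ?_)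
    have hs0 : 0 < s := by linarith
    have h1 : k * (s⁻¹ * z) - j * (b * z) ≤ |z| / 8 := by
      calc k * (s⁻¹ * z) - j * (b * z) = ((k : ℝ) / s - j * b) * z := by field_simp
        _ ≤ |((k : ℝ) / s - j * b) * z| := le_abs_self _
        _ = |(k : ℝ) / s - j * b| * |z| := abs_mul _ _
        _ ≤ 1 / 8 * |z| := by gcongr
        _ = _ := by ring
    have h2 : |s⁻¹ * z| ≤ |z| := by
      rw [abs_mul, abs_of_pos (inv_pos.2 hs0)]
      exact mul_le_of_le_one_left (abs_nonneg z) (inv_le_one_of_one_le₀ hs)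
    have h3 : (|z| - 2) / 4 ≤ k * ((s⁻¹ * z) ^ 2 / (2 * (2 + |s⁻¹ * z|))) := by
      calc (|z| - 2) / 4 ≤ z ^ 2 / (4 * (2 + |z|)) := by
            rw [le_div_iff₀ (by positivity)]
            nlinarith [sq_abs z]
        _ = s ^ 2 / 2 * ((s⁻¹ * z) ^ 2 / (2 * (2 + |z|))) := by field_simp; norm_num
        _ ≤ _ := by gcongr
    linarith
  · positivity

theorem tendsto_natCast_mul_log_one_add_sub {a : ℕ → ℕ} {u : ℕ → ℝ} {L : ℝ}
    (hu : Tendsto u atTop (nhds 0)) (h : Tendsto (fun n => a n * u n ^ 2) atTop (nhds L)) :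
    Tendsto (fun n => a n * (log (1 + u n) - u n)) atTop (nhds (-L / 2)) := by
  have habs : Tendsto (fun n => |u n|) atTop (nhds 0) := by simpa using hu.abs
  have hrem : Tendsto (fun n => a n * (log (1 + u n) - u n + u n ^ 2 / 2)) atTop (nhds 0) := by
    have hbd : Tendsto (fun n => a n * u n ^ 2 * (|u n| / (1 - |u n|))) atTop (nhds 0) := by
      simpa using h.mul (habs.div (habs.const_sub 1) (by norm_num))
    refine squeeze_zero_norm' ?_ hbd
    filter_upwards [habs.eventually_lt_const one_pos] with n hn
    have hlog := abs_log_sub_add_sum_range_le (x := -u n) (by simpa using hn) 2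
    have hsum : (∑ i ∈ Finset.range 2, (-u n) ^ (i + 1) / ((i : ℝ) + 1)) + log (1 - -u n) =
        log (1 + u n) - u n + u n ^ 2 / 2 := by
      rw [Finset.sum_range_succ, Finset.sum_range_one, sub_neg_eq_add]
      push_cast
      ring
    have hpow : |u n| ^ (2 + 1) / (1 - |u n|) = u n ^ 2 * (|u n| / (1 - |u n|)) := by
      rw [← sq_abs (u n)]
      ring
    rw [hsum, abs_neg, hpow] at hlog
    rw [norm_mul, Real.norm_of_nonneg (by positivity : (0 : ℝ) ≤ a n), Real.norm_eq_abs, mul_assoc]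
    exact mul_le_mul_of_nonneg_left hlog (Nat.cast_nonneg _)
  convert hrem.sub (h.div_const 2) using 1
  · ext n; ring
  · ring_nf

theorem tendsto_betaKernel {k j : ℕ → ℕ} {a b : ℕ → ℝ}
    (ha : Tendsto a atTop (nhds 0)) (hb : Tendsto b atTop (nhds 0))
    (hka : Tendsto (fun n => k n * a n ^ 2) atTop (nhds 1))
    (hjb : Tendsto (fun n => j n * b n ^ 2) atTop (nhds 0))
    (hlin : Tendsto (fun n => k n * a n - j n * b n) atTop (nhds 0)) (z : ℝ) :
    Tendsto (fun n => betaKernel (k n) (j n) (a n) (b n) z) atTop (nhds (exp (-z ^ 2 / 2))) := by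
  have hu : Tendsto (fun n => a n * z) atTop (nhds 0) := by simpa using ha.mul_const z
  have hv : Tendsto (fun n => -(b n * z)) atTop (nhds 0) := by simpa using (hb.mul_const z).neg
  have h1 : Tendsto (fun n => k n * (log (1 + a n * z) - a n * z)) atTop (nhds (-z ^ 2 / 2)) := by
    refine tendsto_natCast_mul_log_one_add_sub hu ?_
    convert hka.mul_const (z ^ 2) using 1
    · ext n; ring
    · ring_nf
  have h2 : Tendsto (fun n => j n * (log (1 + -(b n * z)) - -(b n * z))) atTop (nhds (-0 / 2)) := by
    refine tendsto_natCast_mul_log_one_add_sub hv ?_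
    convert hjb.mul_const (z ^ 2) using 1
    · ext n; ring
    · ring_nf
  have h3 := ((h1.add h2).add (hlin.mul_const z)).rexp
  simp only [neg_zero, zero_div, add_zero, zero_mul] at h3
  refine h3.congr' ?_
  filter_upwards [hu.eventually_const_lt (show (-1 : ℝ) < 0 by norm_num),
    hv.eventually_const_lt (show (-1 : ℝ) < 0 by norm_num)] with n hn hn'
  have hp : 0 < 1 + a n * z := by linarith
  have hq : 0 < 1 - b n * z := by linarith
  rw [betaKernel, if_pos ⟨hp.le, hq.le⟩]
  conv_rhs => rw [← exp_log hp, ← exp_log hq]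
  rw [← exp_nat_mul, ← exp_nat_mul, ← exp_add, ← sub_eq_add_neg]
  ring_nf

theorem integrable_exp_sub_abs_div (c : ℝ) {d : ℝ} (hd : 0 < d) :
    Integrable (fun z : ℝ => exp (c - |z| / d)) := by
  have h : IntegrableOn (fun z : ℝ => exp (c - |z| / d)) (Set.Ioi 0) := by
    have h' : IntegrableOn (fun z : ℝ => exp c * exp (-d⁻¹ * z)) (Set.Ioi 0) :=
      (integrableOn_exp_mul_Ioi (by simpa using hd) 0).const_mul (exp c)
    refine h'.congr_fun (fun z hz => ?_) measurableSet_Ioi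
    simp only [← exp_add, abs_of_pos (Set.mem_Ioi.1 hz)]
    ring_nf
  have h' : IntegrableOn (fun z : ℝ => exp (c - |z| / d)) (Set.Iic 0) := by
    rw [integrableOn_Iic_iff_integrableOn_Iio]
    simpa using h.comp_neg
  rw [← integrableOn_univ, ← Set.Iic_union_Ioi (a := (0 : ℝ))]
  exact h'.union h

theorem choose_mul_eq_one_div_beta {n k : ℕ} (hk : k ≤ n) :
    ((n : ℝ) + 1) * (n.choose k : ℝ) =
      1 / ProbabilityTheory.beta ((k : ℝ) + 1) ((n - k : ℕ) + 1) := by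
  have h : (k : ℝ) + 1 + ((n - k : ℕ) + 1) = ((n + 1 : ℕ) : ℝ) + 1 := by
    push_cast [Nat.cast_sub hk]; ring
  rw [ProbabilityTheory.beta, h, Real.Gamma_nat_eq_factorial, Real.Gamma_nat_eq_factorial,
    Real.Gamma_nat_eq_factorial, Nat.cast_choose ℝ hk, Nat.factorial_succ]
  have := Nat.factorial_pos k
  have := Nat.factorial_pos (n - k)
  push_cast
  field_simp

theorem integral_betaDensity {n k : ℕ} (hk : k ≤ n) : ∫ p, betaDensity n k p = 1 := by
  have hae : betaDensity n k =ᵐ[volume]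
      ProbabilityTheory.betaPDFReal ((k : ℝ) + 1) ((n - k : ℕ) + 1) := by
    filter_upwards [compl_mem_ae_iff.2 (measure_singleton (0 : ℝ)),
      compl_mem_ae_iff.2 (measure_singleton (1 : ℝ))] with p h0 h1
    have h : (0 ≤ p ∧ p ≤ 1) ↔ (0 < p ∧ p < 1) :=
      and_congr (Ne.le_iff_lt (Ne.symm h0)) (Ne.le_iff_lt h1)
    simp only [betaDensity, ProbabilityTheory.betaPDFReal, h, choose_mul_eq_one_div_beta hk,
      add_sub_cancel_right, rpow_natCast]
  have hα : (0 : ℝ) < (k : ℝ) + 1 := by positivity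
  have hβ : (0 : ℝ) < ((n - k : ℕ) : ℝ) + 1 := by positivity
  rw [integral_congr_ae hae, integral_eq_lintegral_of_nonneg_ae]
  · have := ProbabilityTheory.lintegral_betaPDF_eq_one hα hβ
    unfold ProbabilityTheory.betaPDF at this
    rw [this, ENNReal.toReal_one]
  · refine Eventually.of_forall fun p => ?_
    by_cases hp : 0 < p ∧ p < 1
    · exact (ProbabilityTheory.betaPDFReal_pos hp.1 hp.2 hα hβ).le
    · simp [ProbabilityTheory.betaPDFReal, hp]
  · exact (ProbabilityTheory.measurable_betaPDFReal _ _).aestronglyMeasurable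

theorem betaDensity_affine_eq {n k : ℕ} {s : ℝ} (hs : 0 < s) (hsn : s ^ 2 < n) (z : ℝ) :
    betaDensity n k (s ^ 2 / n + s / n * z) =
      ((n : ℝ) + 1) * n.choose k * (s ^ 2 / n) ^ k * (1 - s ^ 2 / n) ^ (n - k) *
        betaKernel k (n - k) s⁻¹ (s / (n - s ^ 2)) z := by
  have hn : (0 : ℝ) < n := by nlinarith
  have hd : (0 : ℝ) < n - s ^ 2 := by linarith
  have hp : s ^ 2 / n + s / n * z = s ^ 2 / n * (1 + s⁻¹ * z) := by field_simp
  have hq : 1 - (s ^ 2 / n + s / n * z) = (1 - s ^ 2 / n) * (1 - s / (n - s ^ 2) * z) := by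
    field_simp; ring
  have hq0 : 0 < 1 - s ^ 2 / n := by rw [sub_pos, div_lt_one hn]; exact hsn
  have hiff : (0 ≤ s ^ 2 / n + s / n * z ∧ s ^ 2 / n + s / n * z ≤ 1) ↔
      (0 ≤ 1 + s⁻¹ * z ∧ 0 ≤ 1 - s / (n - s ^ 2) * z) := by
    rw [← sub_nonneg (b := s ^ 2 / n + s / n * z), hq, hp, mul_nonneg_iff_of_pos_left (by positivity),
      mul_nonneg_iff_of_pos_left hq0]
  unfold betaDensity betaKernel
  simp only [hiff, hq]
  split_ifs
  · rw [hp, mul_pow, mul_pow]; ring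
  · ring

theorem integral_scaled_betaDensity {n k : ℕ} {s : ℝ} (hk : k ≤ n) (hs : 0 < s) (hn : 0 < n) :
    ∫ z, s / n * betaDensity n k (s ^ 2 / n + s / n * z) = 1 := by
  have hc : (0 : ℝ) < s / n := by positivity
  rw [integral_const_mul,
    Measure.integral_comp_mul_left (fun y => betaDensity n k (s ^ 2 / n + y)) (s / n),
    integral_add_left_eq_self, integral_betaDensity hk, abs_of_pos (inv_pos.2 hc), smul_eq_mul,
    mul_one, mul_inv_cancel₀ hc.ne']

theorem integral_stdGaussian_kernel : ∫ z : ℝ, exp (-z ^ 2 / 2) = √(2 * π) := by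
  have := integral_gaussian (1 / 2)
  convert this using 3
  · congr 1; ring
  · ring

theorem tendsto_integral_mul_scaled_betaDensity {s : ℕ → ℝ} (hs : Tendsto s atTop atTop)
    (hsn : Tendsto (fun n => s n ^ 2 / n) atTop (nhds 0)) (g : BoundedContinuousFunction ℝ ℝ) :
    Tendsto (fun n : ℕ => ∫ z, g z *
        (s n / n * betaDensity n ⌊s n ^ 2⌋₊ (s n ^ 2 / n + s n / n * z))) atTop
      (nhds (∫ z, g z * stdGaussianDensity z)) := by
  set k : ℕ → ℕ := fun n => ⌊s n ^ 2⌋₊ with hk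
  set b : ℕ → ℝ := fun n => s n / (n - s n ^ 2) with hb
  have hs2 : Tendsto (fun n => s n ^ 2) atTop atTop := (tendsto_pow_atTop two_ne_zero).comp hs
  have hinv : Tendsto (fun n => (s n)⁻¹) atTop (nhds 0) := tendsto_inv_atTop_zero.comp hs
  have hev : ∀ᶠ n : ℕ in atTop, 0 < n ∧ 16 ≤ s n ∧ s n ^ 2 / n ≤ 1 / 2 := by
    filter_upwards [eventually_gt_atTop 0, hs.eventually_ge_atTop 16,
      hsn.eventually_le_const (show (0 : ℝ) < 1 / 2 by norm_num)] with n h1 h2 h3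
    exact ⟨h1, h2, h3⟩
  have hle : ∀ n : ℕ, 0 < n → s n ^ 2 / n ≤ 1 / 2 → s n ^ 2 ≤ n / 2 := by
    intro n hn h
    rw [div_le_iff₀ (by positivity)] at h
    linarith
  have hkle : ∀ n : ℕ, 0 < n → s n ^ 2 / n ≤ 1 / 2 → k n ≤ n := by
    intro n hn h
    have h1 : (0 : ℝ) < n := by positivity
    exact Nat.floor_le_of_le (by linarith [hle n hn h])
  have hlin : ∀ᶠ n : ℕ in atTop, |(k n : ℝ) / s n - (n - k n : ℕ) * b n| ≤ 2 * (s n)⁻¹ := by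
    filter_upwards [hev] with n ⟨hn, hs16, hq⟩
    have hn' : (0 : ℝ) < n := by positivity
    have h1 := hle n hn hq
    have hs0 : 0 < s n := by linarith
    have hd : (0 : ℝ) < n - s n ^ 2 := by linarith
    have hf1 : (k n : ℝ) ≤ s n ^ 2 := Nat.floor_le (by positivity)
    have hf2 : s n ^ 2 < k n + 1 := Nat.lt_floor_add_one _
    have heq : (k n : ℝ) / s n - (n - k n : ℕ) * b n =
        -((s n ^ 2 - k n) * (n / (n - s n ^ 2)) * (s n)⁻¹) := by
      rw [Nat.cast_sub (hkle n hn hq), hb]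
      field_simp
      ring
    rw [heq, abs_neg, abs_of_nonneg (by have := sub_nonneg.2 hf1; positivity)]
    have h2 : (n : ℝ) / (n - s n ^ 2) ≤ 2 := by rw [div_le_iff₀ hd]; linarith
    have h3 : (s n ^ 2 - k n) * (n / (n - s n ^ 2)) ≤ 1 * 2 := by
      gcongr
      linarith
    gcongr
    linarith
  have hb2 : Tendsto (fun n : ℕ => (n : ℝ) * b n ^ 2) atTop (nhds 0) := by
    have h : Tendsto (fun n : ℕ => s n ^ 2 / n / (1 - s n ^ 2 / n) ^ 2) atTop (nhds 0) := by
      simpa [Pi.div_def] using hsn.div ((hsn.const_sub 1).pow 2) (by norm_num)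
    refine h.congr' ?_
    filter_upwards [hev] with n ⟨hn, hs16, hq⟩
    have hn' : (0 : ℝ) < n := by positivity
    have hd : (n : ℝ) - s n ^ 2 ≠ 0 := by linarith [hle n hn hq]
    simp only [hb]
    field_simp
  have hjb : Tendsto (fun n : ℕ => ((n - k n : ℕ) : ℝ) * b n ^ 2) atTop (nhds 0) := by
    refine squeeze_zero (fun n => by positivity) (fun n => ?_) hb2
    gcongr
    exact Nat.sub_le _ _
  have hb0 : Tendsto b atTop (nhds 0) := by
    have h : Tendsto (fun n => b n ^ 2) atTop (nhds 0) := by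
      refine squeeze_zero' (Eventually.of_forall fun n => by positivity) ?_ hb2
      filter_upwards [eventually_gt_atTop 0] with n hn
      exact le_mul_of_one_le_left (sq_nonneg _) (by exact_mod_cast hn)
    rw [tendsto_zero_iff_abs_tendsto_zero]
    simpa [Real.sqrt_sq_eq_abs, Function.comp_def] using h.sqrt
  have hka : Tendsto (fun n => k n * (s n)⁻¹ ^ 2) atTop (nhds 1) := by
    refine ((tendsto_nat_floor_div_atTop (R := ℝ)).comp hs2).congr fun n => ?_
    simp [hk, div_eq_mul_inv]
  have hlin0 : Tendsto (fun n => k n * (s n)⁻¹ - ((n - k n : ℕ) : ℝ) * b n) atTop (nhds 0) := by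
    refine squeeze_zero_norm' ?_ (by simpa using hinv.const_mul 2)
    filter_upwards [hlin] with n hn
    rwa [Real.norm_eq_abs, ← div_eq_mul_inv]
  set w : ℕ → ℝ → ℝ := fun n => betaKernel (k n) (n - k n) (s n)⁻¹ (b n)
  have hwbd : ∀ᶠ n in atTop, ∀ z, w n z ≤ exp (1 / 2 - |z| / 8) := by
    filter_upwards [hev, hlin] with n ⟨hn, hs16, hq⟩ hl z
    refine betaKernel_le (by linarith) ?_ (hl.trans ?_) z
    · have hf2 : s n ^ 2 < k n + 1 := Nat.lt_floor_add_one _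
      nlinarith
    · rw [← div_eq_mul_inv, div_le_iff₀ (by linarith)]
      linarith
  have hlim : ∀ f : BoundedContinuousFunction ℝ ℝ,
      Tendsto (fun n => ∫ z, f z * w n z) atTop (nhds (∫ z, f z * exp (-z ^ 2 / 2))) := by
    intro f
    refine tendsto_integral_filter_of_dominated_convergence
      (fun z => ‖f‖ * exp (1 / 2 - |z| / 8)) ?_ ?_ ?_ ?_
    · exact Eventually.of_forall fun n =>
        (f.continuous.measurable.mul (measurable_betaKernel _ _ _ _)).aestronglyMeasurable
    · filter_upwards [hwbd] with n hn
      refine Eventually.of_forall fun z => ?_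
      rw [norm_mul, Real.norm_of_nonneg (betaKernel_nonneg _ _ _ _ _)]
      exact mul_le_mul (f.norm_coe_le_norm z) (hn z) (betaKernel_nonneg _ _ _ _ _) (norm_nonneg _)
    · exact (integrable_exp_sub_abs_div _ (by norm_num)).const_mul _
    · exact Eventually.of_forall fun z =>
        (tendsto_betaKernel hinv hb0 hka hjb hlin0 z).const_mul _
  have hden := hlim (BoundedContinuousFunction.const ℝ 1)
  simp only [BoundedContinuousFunction.const_apply, one_mul, integral_stdGaussian_kernel] at hden
  have hquot := (hlim g).div hden (by positivity)
  have hval : ∫ z, g z * stdGaussianDensity z = (∫ z, g z * exp (-z ^ 2 / 2)) / √(2 * π) := by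
    simp only [stdGaussianDensity, ← mul_div_assoc, integral_div]
  rw [hval]
  refine hquot.congr' ?_
  filter_upwards [hev] with n ⟨hn, hs16, hq⟩
  have hn' : (0 : ℝ) < n := by positivity
  have hs0 : 0 < s n := by linarith
  have hlt : s n ^ 2 < n := by linarith [hle n hn hq]
  obtain ⟨C, hC⟩ : ∃ C : ℝ, ∀ z,
      s n / n * betaDensity n ⌊s n ^ 2⌋₊ (s n ^ 2 / n + s n / n * z) = C * w n z :=
    ⟨_, fun z => by rw [betaDensity_affine_eq hs0 hlt, ← mul_assoc]⟩
  have hone := integral_scaled_betaDensity (k := ⌊s n ^ 2⌋₊) (hkle n hn hq) hs0 hn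
  simp only [hC, integral_const_mul] at hone
  simp only [hC, mul_left_comm _ C, integral_const_mul]
  rw [Pi.div_apply, div_eq_iff (right_ne_zero_of_mul (hone.trans_ne one_ne_zero)), mul_right_comm, hone, one_mul]

/-- For `β ∈ (0,1)` and `x_n = ⌊n^β⌋`, the standardized variable
`Z̃_n = n^{1-β/2} (Z_n - n^{β-1})` converges weakly to a standard Gaussian:
for every bounded continuous test function the integrals converge. -/
theorem weak_convergence_to_gaussian_beta
    (β : ℝ) (hβ : β ∈ Set.Ioo (0 : ℝ) 1) :
    ∀ g : BoundedContinuousFunction ℝ ℝ,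
      Tendsto (fun n : ℕ => ∫ z : ℝ, g z * tildeDensityBeta β n z) atTop
        (nhds (∫ z : ℝ, g z * stdGaussianDensity z)) := by
  obtain ⟨h0, h1⟩ := hβ
  intro g
  have hs : Tendsto (fun n : ℕ => (n : ℝ) ^ (β / 2)) atTop atTop :=
    (tendsto_rpow_atTop (by linarith)).comp tendsto_natCast_atTop_atTop
  have hsq : ∀ n : ℕ, ((n : ℝ) ^ (β / 2)) ^ 2 = (n : ℝ) ^ β := fun n => by
    rw [← rpow_natCast, ← rpow_mul n.cast_nonneg]
    norm_num
  have hdiv : ∀ {n : ℕ}, 0 < n → ∀ a : ℝ, (n : ℝ) ^ a / n = (n : ℝ) ^ (a - 1) := fun hn a => by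
    rw [rpow_sub_one (by positivity)]
  have hsn : Tendsto (fun n : ℕ => ((n : ℝ) ^ (β / 2)) ^ 2 / n) atTop (nhds 0) := by
    refine ((tendsto_rpow_neg_atTop (y := 1 - β) (by linarith)).comp
      tendsto_natCast_atTop_atTop).congr' ?_
    filter_upwards [eventually_gt_atTop 0] with n hn
    simp [hsq, hdiv hn]
  refine (tendsto_integral_mul_scaled_betaDensity hs hsn g).congr' ?_
  filter_upwards [eventually_gt_atTop 0] with n hn
  simp only [tildeDensityBeta, hsq, hdiv hn]
end

section
/- Fix a positive integer c₁ and take x = c₁ for all n. Then lim_{n→∞} [ h(f_{n,c₁}) + log n ] = c₁ + log(c₁!) − c₁·(H_{c₁} − γ) + 1, where H_{c₁} = 1 + 1/2 + ⋯ + 1/c₁ is the partial sum of the harmonic series and γ is the Euler–Mascheroni constant. Equivalently, the differential entropy of the density of n·Z_n, where Z_n has density f_{n,c₁}, converges to this constant as n → ∞. -/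
open MeasureTheory Real Filter

/-- Differential entropy `h(f) = -∫ f log f`. -/
noncomputable def diffEntropy (f : ℝ → ℝ) : ℝ :=
  -∫ z : ℝ, f z * Real.log (f z)

/-- Partial sum of the harmonic series `H_k = 1 + 1/2 + ⋯ + 1/k`. -/
noncomputable def harmonicSum (k : ℕ) : ℝ :=
  ∑ i ∈ Finset.range k, (1 : ℝ) / (i + 1)

/-- Density of `n · Z_n` where `Z_n` has density `f_{n,c}`. -/
noncomputable def scaledDensity (c : ℕ) (n : ℕ) (z : ℝ) : ℝ :=
  (1 / (n : ℝ)) * betaDensity n c (z / n)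

lemma harmonicSum_eq_harmonic (k : ℕ) : harmonicSum k = (harmonic k : ℝ) := by
  simp [harmonicSum, harmonic]

lemma harmonicSum_succ (k : ℕ) : harmonicSum (k + 1) = harmonicSum k + 1 / ((k : ℝ) + 1) := by
  simp [harmonicSum, Finset.sum_range_succ]

lemma integral_pow_mul_log (a : ℕ) :
    ∫ p in (0 : ℝ)..1, p ^ a * log p = -1 / ((a : ℝ) + 1) ^ 2 := by
  have ha : (a : ℝ) + 1 ≠ 0 := by positivity
  have hF : Continuous fun p : ℝ =>
      p ^ a * (p * log p) / ((a : ℝ) + 1) - p ^ (a + 1) / ((a : ℝ) + 1) ^ 2 := by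
    have := continuous_mul_log
    fun_prop
  rw [intervalIntegral.integral_eq_sub_of_hasDerivAt_of_le zero_le_one hF.continuousOn]
  · simp [neg_div]
  · intro p hp
    have hp0 : p ≠ 0 := hp.1.ne'
    have h1 : HasDerivAt (fun p : ℝ => p ^ (a + 1)) (((a : ℝ) + 1) * p ^ a) p := by
      simpa using hasDerivAt_pow (a + 1) p
    have h2 := ((h1.mul (hasDerivAt_log hp0)).div_const ((a : ℝ) + 1)).sub
      (h1.div_const (((a : ℝ) + 1) ^ 2))
    convert h2 using 1
    · ext q
      simp [pow_succ, mul_assoc]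
    · field_simp
      ring
  · exact intervalIntegral.intervalIntegrable_log'.continuousOn_mul (by fun_prop)

lemma intervalIntegrable_pow_mul_pow_mul_log (a b : ℕ) :
    IntervalIntegrable (fun p : ℝ => p ^ a * (1 - p) ^ b * log p) volume 0 1 :=
  intervalIntegral.intervalIntegrable_log'.continuousOn_mul (by fun_prop)

lemma intervalIntegrable_pow_mul_pow_mul_log_one_sub (a b : ℕ) :
    IntervalIntegrable (fun p : ℝ => p ^ a * (1 - p) ^ b * log (1 - p)) volume 0 1 := by
  have h := (intervalIntegrable_pow_mul_pow_mul_log b a).comp_sub_left 1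
  simp only [sub_sub_cancel, sub_zero, sub_self] at h
  exact h.symm.congr (fun p _ => by ring)

lemma integral_pow_mul_one_sub_pow (a b : ℕ) :
    ∫ p in (0 : ℝ)..1, p ^ a * (1 - p) ^ b =
      (a.factorial * b.factorial : ℝ) / (a + b + 1).factorial := by
  induction b generalizing a with
  | zero =>
    simp only [pow_zero, mul_one, integral_pow, Nat.factorial_succ, add_zero]
    have := Nat.factorial_pos a
    push_cast
    simp
    field_simp
  | succ b ih =>
    have h : ∀ p : ℝ, p ^ a * (1 - p) ^ (b + 1) =
        p ^ a * (1 - p) ^ b - p ^ (a + 1) * (1 - p) ^ b := fun p => by ring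
    simp_rw [h]
    rw [intervalIntegral.integral_sub (Continuous.intervalIntegrable (by fun_prop) _ _)
      (Continuous.intervalIntegrable (by fun_prop) _ _), ih, ih,
      show a + 1 + b + 1 = a + b + 1 + 1 by ring, show a + (b + 1) + 1 = a + b + 1 + 1 by ring,
      Nat.factorial_succ (a + b + 1), Nat.factorial_succ a, Nat.factorial_succ b]
    have := Nat.factorial_pos (a + b + 1)
    push_cast
    field_simp
    ring

lemma integral_pow_mul_one_sub_pow_mul_log (a b : ℕ) :
    ∫ p in (0 : ℝ)..1, p ^ a * (1 - p) ^ b * log p =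
      (a.factorial * b.factorial : ℝ) / (a + b + 1).factorial *
        (harmonicSum a - harmonicSum (a + b + 1)) := by
  induction b generalizing a with
  | zero =>
    simp only [pow_zero, mul_one, integral_pow_mul_log, Nat.factorial_succ, add_zero,
      harmonicSum_succ]
    have := Nat.factorial_pos a
    push_cast
    simp
    field_simp
  | succ b ih =>
    have h : ∀ p : ℝ, p ^ a * (1 - p) ^ (b + 1) * log p =
        p ^ a * (1 - p) ^ b * log p - p ^ (a + 1) * (1 - p) ^ b * log p := fun p => by ring
    simp_rw [h]
    rw [intervalIntegral.integral_sub (intervalIntegrable_pow_mul_pow_mul_log a b)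
      (intervalIntegrable_pow_mul_pow_mul_log (a + 1) b), ih, ih,
      show a + 1 + b + 1 = a + b + 1 + 1 by ring, show a + (b + 1) + 1 = a + b + 1 + 1 by ring,
      Nat.factorial_succ (a + b + 1), Nat.factorial_succ a, Nat.factorial_succ b,
      harmonicSum_succ (a + b + 1), harmonicSum_succ a]
    have := Nat.factorial_pos (a + b + 1)
    push_cast
    field_simp
    ring

lemma integral_pow_mul_one_sub_pow_mul_log_one_sub (a b : ℕ) :
    ∫ p in (0 : ℝ)..1, p ^ a * (1 - p) ^ b * log (1 - p) =
      (a.factorial * b.factorial : ℝ) / (a + b + 1).factorial *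
        (harmonicSum b - harmonicSum (a + b + 1)) := by
  have h := intervalIntegral.integral_comp_sub_left (a := 0) (b := 1)
    (fun p : ℝ => p ^ b * (1 - p) ^ a * log p) 1
  simp only [sub_sub_cancel, sub_zero, sub_self] at h
  rw [integral_pow_mul_one_sub_pow_mul_log, add_comm b a, mul_comm (b.factorial : ℝ)] at h
  rw [← h]
  exact intervalIntegral.integral_congr fun p _ => by ring

lemma betaDensity_add_eq_indicator (m x : ℕ) :
    betaDensity (m + x) x = (Set.Icc (0 : ℝ) 1).indicator fun p =>
      ((m + x).choose x * ((m + x : ℕ) + 1 : ℝ)) * (p ^ x * (1 - p) ^ m) := by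
  ext p
  simp only [betaDensity, Set.indicator, Set.mem_Icc, Nat.add_sub_cancel]
  split_ifs
  · ring
  · rfl

lemma choose_mul_succ_eq (m x : ℕ) :
    ((m + x).choose x * ((m + x : ℕ) + 1 : ℝ)) =
      (x + m + 1).factorial / (x.factorial * m.factorial : ℝ) := by
  have h := Nat.add_choose_mul_factorial_mul_factorial m x
  rw [add_comm x m, Nat.factorial_succ, ← h]
  have := Nat.factorial_pos m
  have := Nat.factorial_pos x
  rw [← Nat.choose_symm_add]
  push_cast
  field_simp

lemma integrable_betaDensity (m x : ℕ) : Integrable (betaDensity (m + x) x) := by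
  rw [betaDensity_add_eq_indicator, integrable_indicator_iff measurableSet_Icc]
  exact ContinuousOn.integrableOn_Icc (by fun_prop)

lemma integral_betaDensity_s5 (m x : ℕ) : ∫ p, betaDensity (m + x) x p = 1 := by
  rw [betaDensity_add_eq_indicator, integral_indicator measurableSet_Icc, integral_const_mul,
    integral_Icc_eq_integral_Ioc, ← intervalIntegral.integral_of_le zero_le_one,
    integral_pow_mul_one_sub_pow, choose_mul_succ_eq]
  have := Nat.factorial_pos (x + m + 1)
  have := Nat.factorial_pos m
  have := Nat.factorial_pos x
  field_simp

/-- On `(0, 1)`, expansion of the integrand `f log f` of the entropy of a Beta density. -/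
lemma betaDensity_mul_log_ae_eq (m x : ℕ) :
    (fun p => betaDensity (m + x) x p * log (betaDensity (m + x) x p)) =ᵐ[volume]
      (Set.Ioc (0 : ℝ) 1).indicator fun p =>
        ((m + x).choose x * ((m + x : ℕ) + 1 : ℝ)) *
          (log ((m + x).choose x * ((m + x : ℕ) + 1 : ℝ)) * (p ^ x * (1 - p) ^ m) +
            x * (p ^ x * (1 - p) ^ m * log p) + m * (p ^ x * (1 - p) ^ m * log (1 - p))) := by
  have hC : ((m + x).choose x * ((m + x : ℕ) + 1 : ℝ)) ≠ 0 := by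
    have : 0 < (m + x).choose x := Nat.choose_pos (by omega)
    positivity
  filter_upwards [Measure.ae_ne volume (0 : ℝ), Measure.ae_ne volume (1 : ℝ)] with p h0 h1
  rw [betaDensity_add_eq_indicator]
  by_cases hp : p ∈ Set.Icc (0 : ℝ) 1
  · have h1' : 1 - p ≠ 0 := sub_ne_zero.mpr h1.symm
    rw [Set.indicator_of_mem hp, Set.indicator_of_mem (show p ∈ Set.Ioc (0 : ℝ) 1 from ⟨lt_of_le_of_ne hp.1 h0.symm, hp.2⟩),
      log_mul hC (mul_ne_zero (pow_ne_zero _ h0) (pow_ne_zero _ h1')),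
      log_mul (pow_ne_zero _ h0) (pow_ne_zero _ h1'), log_pow, log_pow]
    ring
  · rw [Set.indicator_of_notMem hp, Set.indicator_of_notMem fun h => hp ⟨h.1.le, h.2⟩, zero_mul]

lemma integrable_betaDensity_mul_log (m x : ℕ) :
    Integrable fun p => betaDensity (m + x) x p * log (betaDensity (m + x) x p) := by
  rw [integrable_congr (betaDensity_mul_log_ae_eq m x),
    integrable_indicator_iff measurableSet_Ioc,
    ← intervalIntegrable_iff_integrableOn_Ioc_of_le zero_le_one]
  exact (((Continuous.intervalIntegrable (by fun_prop) _ _).const_mul _ |>.add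
    ((intervalIntegrable_pow_mul_pow_mul_log x m).const_mul _)).add
    ((intervalIntegrable_pow_mul_pow_mul_log_one_sub x m).const_mul _)).const_mul _

/-- Closed form of the entropy of the Beta density with integer parameters. -/
lemma diffEntropy_betaDensity (m x : ℕ) :
    diffEntropy (betaDensity (m + x) x) =
      -log ((x + m + 1).factorial / (x.factorial * m.factorial : ℝ))
        + x * (harmonicSum (x + m + 1) - harmonicSum x)
        + m * (harmonicSum (x + m + 1) - harmonicSum m) := by
  have h0 : IntervalIntegrable (fun p : ℝ => p ^ x * (1 - p) ^ m) volume 0 1 :=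
    Continuous.intervalIntegrable (by fun_prop) _ _
  have h1 := intervalIntegrable_pow_mul_pow_mul_log x m
  have h2 := intervalIntegrable_pow_mul_pow_mul_log_one_sub x m
  rw [diffEntropy, integral_congr_ae (betaDensity_mul_log_ae_eq m x),
    integral_indicator measurableSet_Ioc, ← intervalIntegral.integral_of_le zero_le_one,
    intervalIntegral.integral_const_mul,
    intervalIntegral.integral_add ((h0.const_mul _).add (h1.const_mul _)) (h2.const_mul _),
    intervalIntegral.integral_add (h0.const_mul _) (h1.const_mul _),
    intervalIntegral.integral_const_mul, intervalIntegral.integral_const_mul,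
    intervalIntegral.integral_const_mul, integral_pow_mul_one_sub_pow,
    integral_pow_mul_one_sub_pow_mul_log, integral_pow_mul_one_sub_pow_mul_log_one_sub,
    choose_mul_succ_eq]
  have := Nat.factorial_pos (x + m + 1)
  have := Nat.factorial_pos m
  have := Nat.factorial_pos x
  field_simp
  ring

lemma diffEntropy_scale {f : ℝ → ℝ} (hf : Integrable f) (hf1 : ∫ z, f z = 1)
    (hlog : Integrable fun z => f z * log (f z)) {r : ℝ} (hr : 0 < r) :
    diffEntropy (fun z => 1 / r * f (z / r)) = diffEntropy f + log r := by
  have hpt : ∀ z, f z * log (1 / r * f z) = f z * log (f z) - f z * log r := by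
    intro z
    rcases eq_or_ne (f z) 0 with h | h
    · simp [h]
    · rw [log_mul (by positivity) h, one_div, log_inv]
      ring
  have h := Measure.integral_comp_div (fun z => 1 / r * (f z * log (1 / r * f z))) r
  simp only [diffEntropy, mul_assoc]
  rw [h, integral_const_mul, abs_of_pos hr, smul_eq_mul, ← mul_assoc, mul_one_div_cancel hr.ne',
    one_mul]
  simp_rw [hpt]
  rw [integral_sub hlog (hf.mul_const _), integral_mul_const, hf1]
  ring

lemma diffEntropy_scaledDensity (m x : ℕ) (h : 0 < m + x) :
    diffEntropy (scaledDensity x (m + x)) =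
      diffEntropy (betaDensity (m + x) x) + log ((m + x : ℕ) : ℝ) :=
  diffEntropy_scale (integrable_betaDensity m x) (integral_betaDensity_s5 m x)
    (integrable_betaDensity_mul_log m x) (by exact_mod_cast h)

lemma tendsto_natCast_add_div (a b : ℝ) :
    Tendsto (fun m : ℕ => ((m : ℝ) + a) / (m + b)) atTop (nhds 1) := by
  simpa [add_comm] using tendsto_add_mul_div_add_mul_atTop_nhds a b (1 : ℝ) one_ne_zero

lemma tendsto_mul_harmonicSum_sub (k : ℕ) :
    Tendsto (fun m : ℕ => (m : ℝ) * (harmonicSum (k + m) - harmonicSum m)) atTop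
      (nhds (k : ℝ)) := by
  induction k with
  | zero => simp
  | succ k ih =>
    push_cast
    refine (ih.add (tendsto_natCast_add_div 0 (k + 1))).congr fun m => ?_
    rw [show k + 1 + m = k + m + 1 by ring, harmonicSum_succ]
    push_cast
    ring

lemma tendsto_log_factorial_sub (k : ℕ) (b : ℝ) :
    Tendsto (fun m : ℕ => log ((k + m).factorial / (m.factorial : ℝ)) - k * log (m + b)) atTop
      (nhds 0) := by
  induction k with
  | zero =>
    refine tendsto_const_nhds.congr fun m => ?_
    simp [Nat.factorial_ne_zero]
  | succ k ih =>
    have h := (continuousAt_log one_ne_zero).tendsto.comp (tendsto_natCast_add_div (k + 1) b)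
    rw [log_one] at h
    have h' := ih.add h
    rw [add_zero] at h'
    refine h'.congr' ?_
    have hb : ∀ᶠ m : ℕ in atTop, 0 < (m : ℝ) + b :=
      (tendsto_atTop_add_const_right _ b tendsto_natCast_atTop_atTop).eventually_gt_atTop 0
    filter_upwards [hb] with m hm
    have h1 : ((k + 1 + m).factorial / (m.factorial : ℝ)) =
        (m + (k + 1)) * ((k + m).factorial / (m.factorial : ℝ)) := by
      rw [show k + 1 + m = k + m + 1 by ring, Nat.factorial_succ]
      push_cast
      ring
    have := Nat.factorial_pos (k + m)
    have := Nat.factorial_pos m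
    rw [Function.comp_apply, h1, log_mul (by positivity) (by positivity),
      log_div (by positivity) hm.ne']
    push_cast
    ring

lemma tendsto_harmonicSum_sub_log (x : ℕ) :
    Tendsto (fun m : ℕ => harmonicSum (x + m + 1) - log ((m : ℝ) + x)) atTop
      (nhds eulerMascheroniConstant) := by
  have h := ((tendsto_harmonic_sub_log.add tendsto_one_div_add_atTop_nhds_zero_nat).comp
    (tendsto_add_atTop_nat x))
  rw [add_zero] at h
  refine h.congr fun m => ?_
  rw [Function.comp_apply, add_comm x m, harmonicSum_succ, harmonicSum_eq_harmonic]
  push_cast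
  ring

lemma tendsto_diffEntropy_betaDensity_add_log (x : ℕ) :
    Tendsto (fun n : ℕ => diffEntropy (betaDensity n x) + log n) atTop
      (nhds ((x : ℝ) + log (Nat.factorial x) -
        x * (harmonicSum x - eulerMascheroniConstant) + 1)) := by
  rw [← tendsto_add_atTop_iff_nat x]
  have h1 := (tendsto_log_factorial_sub (x + 1) x).neg
  have h2 := (tendsto_harmonicSum_sub_log x).const_mul (x : ℝ)
  have h3 := tendsto_mul_harmonicSum_sub (x + 1)
  have h4 : Tendsto (fun _ : ℕ => log (Nat.factorial x) - x * harmonicSum x) atTop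
      (nhds (log (Nat.factorial x) - x * harmonicSum x)) := tendsto_const_nhds
  have h := ((h1.add h2).add h3).add h4
  convert h using 1
  · ext m
    have := Nat.factorial_pos (x + m + 1)
    have := Nat.factorial_pos m
    have := Nat.factorial_pos x
    rw [diffEntropy_betaDensity, show x + 1 + m = x + m + 1 by ring,
      log_div (by positivity) (by positivity), log_div (by positivity) (by positivity),
      log_mul (by positivity) (by positivity)]
    push_cast
    ring
  · congr 1
    push_cast
    ring

/-- For a fixed positive integer `c₁` (so `x = c₁` successes for all `n`),
`h(f_{n,c₁}) + log n → c₁ + log(c₁!) - c₁(H_{c₁} - γ) + 1`, where `γ` is the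
Euler–Mascheroni constant; equivalently, the differential entropy of the density of `n·Z_n`
converges to this constant. -/
theorem entropy_asymptotics_constant_successes (c₁ : ℕ) (hc₁ : 0 < c₁) :
    Tendsto (fun n : ℕ => diffEntropy (betaDensity n c₁) + Real.log n) atTop
      (nhds ((c₁ : ℝ) + Real.log (Nat.factorial c₁) -
        c₁ * (harmonicSum c₁ - Real.eulerMascheroniConstant) + 1)) ∧
    Tendsto (fun n : ℕ => diffEntropy (scaledDensity c₁ n)) atTop
      (nhds ((c₁ : ℝ) + Real.log (Nat.factorial c₁) -
        c₁ * (harmonicSum c₁ - Real.eulerMascheroniConstant) + 1)) := by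
  refine ⟨tendsto_diffEntropy_betaDensity_add_log c₁,
    (tendsto_diffEntropy_betaDensity_add_log c₁).congr' ?_⟩
  filter_upwards [eventually_ge_atTop c₁] with n hn
  obtain ⟨m, rfl⟩ := Nat.exists_eq_add_of_le' hn
  rw [diffEntropy_scaledDensity m c₁ (by omega)]
end
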